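/- arXiv:1507.07488 — 2 statements merged into one kernel-verified Lean document; each statement's English description precedes it below -/
import Mathlib

section
/- For every integer p ≥ 0 and every integer n ≥ 1, the commutator [∂_{t̄_n}, D_p] of ℚ-linear endomorphisms of R equals: (n/m)·∂_{t̄_{(p−1)m+n}} if p ≥ 1, or if p = 0 and n > m; (n(m−n)/m)·(multiplication by t̄_{m−n}) if p = 0 and n < m; multiplication by x_0 if p = 0 and n = m. -/
open MvPolynomial

noncomputable section

namespace EBTH

/-- Variables of the polynomial ring: `x n` for `n ≥ 0`, `t n` and `tb n` ("t-bar")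
for `n ≥ 1` (indexed by positive naturals). -/
inductive Var : Type
  | x : ℕ → Var
  | t : {n : ℕ // 0 < n} → Var
  | tb : {n : ℕ // 0 < n} → Var
  deriving DecidableEq

/-- The polynomial algebra `R = ℚ[x₀, x₁, …; t₁, t₂, …; t̄₁, t̄₂, …]`. -/
abbrev P : Type := MvPolynomial Var ℚ

/-- The variable `t n`; intended (and only used) for `n ≥ 1`. -/
def tv (n : ℕ) : Var := Var.t ⟨max n 1, by omega⟩

/-- The variable `t̄ n`; intended (and only used) for `n ≥ 1`. -/
def tbv (n : ℕ) : Var := Var.tb ⟨max n 1, by omega⟩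

/-- Multiplication by a polynomial, as a `ℚ`-linear endomorphism. -/
def mul (f : P) : Module.End ℚ P := LinearMap.mulLeft ℚ f

/-- The partial derivative `∂_v`, as a `ℚ`-linear endomorphism. -/
def pd (v : Var) : Module.End ℚ P := (MvPolynomial.pderiv v).toLinearMap

/-- The commutator `[P,Q] = PQ − QP` of endomorphisms. -/
def comm (f g : Module.End ℚ P) : Module.End ℚ P := f * g - g * f

/-- The first-order (locally finite) part of `D₀`, i.e. the derivation
`(1/k)·Σ_{n≥1}( x_{n+1}·∂_{t_{nk}} + (n+k)·t_{n+k}·∂_{t_n} )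
 + (1/m)·Σ_{n≥1}( x_{n+1}·∂_{t̄_{nm}} + (n+m)·t̄_{n+m}·∂_{t̄_n} )
 + Σ_{n≥1} n·x_n·∂_{x_{n−1}}`,
encoded by its values on the variables. -/
def D0der (k m : ℕ) : Module.End ℚ P :=
  (mkDerivation ℚ fun v => match v with
    | Var.x j => ((j : ℚ) + 1) • X (Var.x (j + 1))
    | Var.t j => (((j : ℚ) + k) / k) • X (tv ((j : ℕ) + k))
        + (if k ∣ (j : ℕ) then (1 / (k : ℚ)) • X (Var.x ((j : ℕ) / k + 1)) else 0)
    | Var.tb j => (((j : ℚ) + m) / m) • X (tbv ((j : ℕ) + m))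
        + (if m ∣ (j : ℕ) then (1 / (m : ℚ)) • X (Var.x ((j : ℕ) / m + 1)) else 0)
  ).toLinearMap

/-- The zero-order part of `D₀`: the polynomial
`(1/(2k))·Σ_{n=1}^{k−1} n(k−n)·t_n t_{k−n} + (1/(2m))·Σ_{n=1}^{m−1} n(m−n)·t̄_n t̄_{m−n}
 + (1/k + 1/m)·x₀x₁ + x₀(t_k + t̄_m)`. -/
def Q0 (k m : ℕ) : P :=
  (1 / (2 * (k : ℚ))) • (∑ i ∈ Finset.range (k - 1),
      (((i : ℚ) + 1) * ((k : ℚ) - ((i : ℚ) + 1))) • (X (tv (i + 1)) * X (tv (k - (i + 1)))))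
  + (1 / (2 * (m : ℚ))) • (∑ i ∈ Finset.range (m - 1),
      (((i : ℚ) + 1) * ((m : ℚ) - ((i : ℚ) + 1))) • (X (tbv (i + 1)) * X (tbv (m - (i + 1)))))
  + ((1 / (k : ℚ)) + (1 / (m : ℚ))) • (X (Var.x 0) * X (Var.x 1))
  + X (Var.x 0) * (X (tv k) + X (tbv m))

/-- The first-order part of `D₁`, i.e. the derivation
`(1/k)·Σ_{n≥1}( x_n·∂_{t_{nk}} + n·t_n·∂_{t_n} )
 + (1/m)·Σ_{n≥1}( x_n·∂_{t̄_{nm}} + n·t̄_n·∂_{t̄_n} ) + Σ_{n≥1} n·x_n·∂_{x_n}`. -/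
def D1der (k m : ℕ) : Module.End ℚ P :=
  (mkDerivation ℚ fun v => match v with
    | Var.x j => (j : ℚ) • X (Var.x j)
    | Var.t j => ((j : ℚ) / k) • X (Var.t j)
        + (if k ∣ (j : ℕ) then (1 / (k : ℚ)) • X (Var.x ((j : ℕ) / k)) else 0)
    | Var.tb j => ((j : ℚ) / m) • X (Var.tb j)
        + (if m ∣ (j : ℕ) then (1 / (m : ℚ)) • X (Var.x ((j : ℕ) / m)) else 0)
  ).toLinearMap

/-- The first-order part of `D_{p+1}` for `p ≥ 1`, i.e. the derivation
`Σ_{n≥1} n·x_n·∂_{x_{p+n}} + (1/k)·Σ_{n≥0}( x_n·∂_{t_{(p+n)k}} + n·t_n·∂_{t_{pk+n}} )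
 + (1/m)·Σ_{n≥0}( x_n·∂_{t̄_{(p+n)m}} + n·t̄_n·∂_{t̄_{pm+n}} )`. -/
def Dbigder (k m p : ℕ) : Module.End ℚ P :=
  (mkDerivation ℚ fun v => match v with
    | Var.x j => if p < j then ((j : ℚ) - (p : ℚ)) • X (Var.x (j - p)) else 0
    | Var.t j =>
        (if k ∣ (j : ℕ) ∧ p ≤ (j : ℕ) / k then
            (1 / (k : ℚ)) • X (Var.x ((j : ℕ) / k - p)) else 0)
        + (if p * k < (j : ℕ) then
            (((j : ℚ) - (p : ℚ) * k) / k) • X (tv ((j : ℕ) - p * k)) else 0)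
    | Var.tb j =>
        (if m ∣ (j : ℕ) ∧ p ≤ (j : ℕ) / m then
            (1 / (m : ℚ)) • X (Var.x ((j : ℕ) / m - p)) else 0)
        + (if p * m < (j : ℕ) then
            (((j : ℚ) - (p : ℚ) * m) / m) • X (tbv ((j : ℕ) - p * m)) else 0)
  ).toLinearMap

/-- The second-order part of `D_{p+1}` for `p ≥ 1`:
`(1/(2k))·Σ_{n=1}^{pk−1} ∂_{t_n}∂_{t_{pk−n}} + (1/(2m))·Σ_{n=1}^{pm−1} ∂_{t̄_n}∂_{t̄_{pm−n}}`. -/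
def Dbig2 (k m p : ℕ) : Module.End ℚ P :=
  (1 / (2 * (k : ℚ))) • (∑ i ∈ Finset.range (p * k - 1),
      pd (tv (i + 1)) * pd (tv (p * k - (i + 1))))
  + (1 / (2 * (m : ℚ))) • (∑ i ∈ Finset.range (p * m - 1),
      pd (tbv (i + 1)) * pd (tbv (p * m - (i + 1))))

/-- The operators `D_p` (`p ≥ 0`) from Section 4.4 of the paper. -/
def D (k m : ℕ) : ℕ → Module.End ℚ P
  | 0 => D0der k m + mul (Q0 k m)
  | 1 => D1der k m
      + mul (((1 / (2 * (k : ℚ))) + (1 / (2 * (m : ℚ)))) • (X (Var.x 0) * X (Var.x 0)))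
  | (p + 2) => Dbigder k m (p + 1) + Dbig2 k m (p + 1)

/-- The subalgebra `F = ℚ[x₁, x₂, …]` of polynomials involving none of the
variables `x₀, t_n, t̄_n`. -/
def Fsub : Subalgebra ℚ P := Algebra.adjoin ℚ (Set.range fun n : ℕ => X (Var.x (n + 1)))

end EBTH

namespace EBTH

lemma tbv_eq_tbv_iff {a b : ℕ} (ha : 1 ≤ a) (hb : 1 ≤ b) : tbv a = tbv b ↔ a = b := by
  simp only [tbv, Var.tb.injEq, Subtype.mk.injEq]
  omega

lemma tb_eq_tbv (j : {n : ℕ // 0 < n}) : Var.tb j = tbv j := by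
  obtain ⟨j, hj⟩ := j
  simp only [tbv, Var.tb.injEq, Subtype.mk.injEq]
  omega

lemma comm_add (f g h : Module.End ℚ P) : comm f (g + h) = comm f g + comm f h := by
  simp only [comm, mul_add, add_mul]
  abel

lemma comm_pd_mul (v : Var) (f : P) : comm (pd v) (mul f) = mul (pderiv v f) := by
  refine LinearMap.ext fun g => ?_
  simp [comm, pd, mul, Derivation.leibniz, mul_comm]

lemma pd_commute (v w : Var) : Commute (pd v) (pd w) := by
  have h : ⁅(pderiv v : Derivation ℚ P P), (pderiv w : Derivation ℚ P P)⁆ = 0 := by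
    refine MvPolynomial.derivation_ext fun i => ?_
    simp only [Derivation.commutator_apply, pderiv_X, Pi.single_apply, Derivation.coe_zero,
      Pi.zero_apply]
    split_ifs <;> simp
  refine LinearMap.ext fun g => ?_
  have := congrArg (fun d : Derivation ℚ P P => d g) h
  simpa [Derivation.commutator_apply, sub_eq_zero, pd] using this

lemma comm_pd_Dbig2 (k m p : ℕ) (v : Var) : comm (pd v) (Dbig2 k m p) = 0 := by
  rw [comm, sub_eq_zero]
  refine Commute.add_right ?_ ?_ <;>
  · refine Commute.smul_right (Commute.sum_right _ _ _ fun i _ => ?_) _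
    exact (pd_commute _ _).mul_right (pd_commute _ _)

/-- The commutator of `∂_v` with a derivation is determined by its values on the variables. -/
lemma comm_pd_mkDerivation (v : Var) (f : Var → P) (E : Derivation ℚ P P)
    (h : ∀ w, pderiv v (f w) = E (X w)) :
    comm (pd v) (mkDerivation ℚ f).toLinearMap = E.toLinearMap := by
  have h' : ⁅pderiv (R := ℚ) v, mkDerivation ℚ f⁆ = E := by
    refine MvPolynomial.derivation_ext fun i => ?_
    rw [← h, Derivation.commutator_apply, mkDerivation_X, pderiv_X, Pi.single_apply]
    split_ifs <;> simp
  rw [← h']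
  rfl

lemma pderiv_tbv_x (n j : ℕ) : pderiv (R := ℚ) (tbv n) (X (Var.x j)) = 0 :=
  pderiv_X_of_ne (by simp [tbv])

lemma pderiv_tbv_t (n : ℕ) (j) : pderiv (R := ℚ) (tbv n) (X (Var.t j)) = 0 :=
  pderiv_X_of_ne (by simp [tbv])

lemma pderiv_tbv_tv (n j : ℕ) : pderiv (R := ℚ) (tbv n) (X (tv j)) = 0 :=
  pderiv_tbv_t _ _

lemma pderiv_tbv_tbv {n j : ℕ} (hn : 1 ≤ n) (hj : 1 ≤ j) :
    pderiv (R := ℚ) (tbv n) (X (tbv j)) = if j = n then 1 else 0 := by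
  simp [pderiv_X, Pi.single_apply, tbv_eq_tbv_iff hj hn]

lemma comm_pd_D0der {k m n : ℕ} (hn : 1 ≤ n) :
    comm (pd (tbv n)) (D0der k m)
      = if m < n then ((n : ℚ) / m) • pd (tbv (n - m)) else 0 := by
  trans (if m < n then ((n : ℚ) / m) • pderiv (tbv (n - m)) else 0 :
    Derivation ℚ P P).toLinearMap
  · refine comm_pd_mkDerivation (tbv n) _ _ ?_
    rintro (j | j | j)
    · by_cases h : m < n <;> simp [-pderiv_X, pderiv_tbv_x, h]
    · dsimp only
      by_cases h : m < n <;> split_ifs <;>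
        simp [-pderiv_X, pderiv_tbv_x, pderiv_tbv_t, pderiv_tbv_tv]
    · have hj := j.2
      have e1 : pderiv (R := ℚ) (tbv n) (if m ∣ (j : ℕ) then
          (1 / (m : ℚ)) • X (Var.x ((j : ℕ) / m + 1)) else 0) = 0 := by
        split_ifs <;> simp [-pderiv_X, pderiv_tbv_x]
      simp only [map_add, e1, add_zero, Derivation.map_smul]
      rw [pderiv_tbv_tbv hn (by omega), tb_eq_tbv]
      by_cases h : m < n
      · rw [if_pos h, Derivation.smul_apply, pderiv_tbv_tbv (by omega) hj]
        by_cases h2 : (j : ℕ) + m = n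
        · rw [if_pos h2, if_pos (by omega), ← h2]
          push_cast
          rfl
        · rw [if_neg h2, if_neg (by omega), smul_zero, smul_zero]
      · rw [if_neg h, if_neg (by omega)]
        simp
  · split_ifs <;> rfl

lemma comm_pd_D1der {k m n : ℕ} (hn : 1 ≤ n) :
    comm (pd (tbv n)) (D1der k m) = ((n : ℚ) / m) • pd (tbv n) := by
  refine comm_pd_mkDerivation (tbv n) (E := ((n : ℚ) / m) • pderiv (tbv n)) _ ?_
  rintro (j | j | j)
  · simp [-pderiv_X, pderiv_tbv_x]
  · dsimp only
    split_ifs <;> simp [-pderiv_X, pderiv_tbv_x, pderiv_tbv_t]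
  · have hj := j.2
    have e1 : pderiv (R := ℚ) (tbv n) (if m ∣ (j : ℕ) then
        (1 / (m : ℚ)) • X (Var.x ((j : ℕ) / m)) else 0) = 0 := by
      split_ifs <;> simp [-pderiv_X, pderiv_tbv_x]
    simp only [map_add, e1, add_zero, Derivation.map_smul, Derivation.smul_apply]
    rw [tb_eq_tbv, pderiv_tbv_tbv hn hj]
    split_ifs with h
    · rw [h]
    · simp

lemma comm_pd_Dbigder {k m p n : ℕ} (hn : 1 ≤ n) :
    comm (pd (tbv n)) (Dbigder k m p) = ((n : ℚ) / m) • pd (tbv (p * m + n)) := by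
  refine comm_pd_mkDerivation (tbv n) (E := ((n : ℚ) / m) • pderiv (tbv (p * m + n))) _ ?_
  rintro (j | j | j)
  · dsimp only
    split_ifs <;> simp [-pderiv_X, pderiv_tbv_x]
  · dsimp only
    split_ifs <;> simp [-pderiv_X, pderiv_tbv_x, pderiv_tbv_t, pderiv_tbv_tv]
  · have hj := j.2
    have e1 : pderiv (R := ℚ) (tbv n) (if m ∣ (j : ℕ) ∧ p ≤ (j : ℕ) / m then
        (1 / (m : ℚ)) • X (Var.x ((j : ℕ) / m - p)) else 0) = 0 := by
      split_ifs <;> simp [-pderiv_X, pderiv_tbv_x]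
    simp only [map_add, e1, zero_add, Derivation.smul_apply]
    rw [tb_eq_tbv, pderiv_tbv_tbv (by omega) hj]
    by_cases h : p * m < j
    · rw [if_pos h, Derivation.map_smul, pderiv_tbv_tbv hn (by omega)]
      by_cases h2 : (j : ℕ) = p * m + n
      · rw [if_pos h2, if_pos (by omega), h2]
        push_cast
        rw [add_sub_cancel_left]
      · rw [if_neg h2, if_neg (by omega), smul_zero, smul_zero]
    · rw [if_neg h, if_neg (by omega)]
      simp

/-- The derivative of the quadratic form in the `t̄`-variables appearing in `Q0`. -/
lemma pderiv_tbv_quadratic {m n : ℕ} (hn : 1 ≤ n) :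
    pderiv (R := ℚ) (tbv n) (∑ i ∈ Finset.range (m - 1),
      (((i : ℚ) + 1) * ((m : ℚ) - ((i : ℚ) + 1))) • (X (tbv (i + 1)) * X (tbv (m - (i + 1)))))
      = if n < m then (2 * ((n : ℚ) * ((m : ℚ) - n))) • X (tbv (m - n)) else 0 := by
  have hterm : ∀ i ∈ Finset.range (m - 1), pderiv (R := ℚ) (tbv n)
      ((((i : ℚ) + 1) * ((m : ℚ) - ((i : ℚ) + 1))) • (X (tbv (i + 1)) * X (tbv (m - (i + 1)))))
      = (if i = n - 1 then ((n : ℚ) * ((m : ℚ) - n)) • X (tbv (m - n)) else 0)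
        + (if i = m - n - 1 ∧ n < m then
            ((n : ℚ) * ((m : ℚ) - n)) • X (tbv (m - n)) else 0) := by
    intro i hi
    rw [Finset.mem_range] at hi
    rw [Derivation.map_smul, Derivation.leibniz, pderiv_tbv_tbv hn (by omega),
      pderiv_tbv_tbv hn (by omega), smul_add, add_comm]
    congr 1
    · by_cases h : i = n - 1
      · obtain rfl : n = i + 1 := by omega
        simp
      · rw [if_neg h, if_neg (by omega)]
        simp
    · by_cases h : i = m - n - 1 ∧ n < m
      · obtain rfl : m = n + (i + 1) := by omega
        rw [if_pos h, if_pos (by omega)]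
        have e : n + (i + 1) - n = i + 1 := by omega
        rw [e, smul_eq_mul, mul_one]
        congr 1
        push_cast
        ring
      · rw [if_neg h, if_neg (by omega)]
        simp
  rw [map_sum, Finset.sum_congr rfl hterm, Finset.sum_add_distrib]
  by_cases h : n < m
  · simp only [h, and_true, if_true]
    rw [Finset.sum_ite_eq', Finset.sum_ite_eq', if_pos (by simp; omega), if_pos (by simp; omega),
      ← add_smul, two_mul]
  · simp only [h, and_false, if_false, Finset.sum_const_zero, add_zero]
    rw [Finset.sum_ite_eq', if_neg (by simp; omega)]

lemma pderiv_tbv_Q0 {k m n : ℕ} (hm : 0 < m) (hn : 1 ≤ n) :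
    pderiv (tbv n) (Q0 k m)
      = (if n < m then (((n : ℚ) * ((m : ℚ) - n)) / m) • X (tbv (m - n)) else 0)
        + if m = n then X (Var.x 0) else 0 := by
  have hm' : (m : ℚ) ≠ 0 := by positivity
  simp only [Q0, map_add, Derivation.map_smul, pderiv_tbv_quadratic hn, map_sum,
    Derivation.leibniz, pderiv_tbv_x, pderiv_tbv_tv, pderiv_tbv_tbv hn hm, smul_zero, add_zero,
    Finset.sum_const_zero, zero_add]
  congr 1
  · split_ifs
    · rw [smul_smul]
      congr 1
      field_simp
    · simp
  · simp

end EBTH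

open EBTH in
/-- for `p ≥ 0`, `n ≥ 1`, the commutator `[∂_{t̄_n}, D_p]` equals
`(n/m)·∂_{t̄_{(p−1)m+n}}` if `p ≥ 1` or (`p = 0` and `n > m`);
`(n(m−n)/m)·(t̄_{m−n}·)` if `p = 0` and `n < m`; and `(x₀·)` if `p = 0`, `n = m`. -/
theorem stmt5 (k m : ℕ) (hk : 0 < k) (hm : 0 < m) (p n : ℕ) (hn : 1 ≤ n) :
    ((1 ≤ p ∨ (p = 0 ∧ m < n)) →
      comm (pd (tbv n)) (D k m p)
        = ((n : ℚ) / m) • pd (tbv ((((p : ℤ) - 1) * m + n).toNat))) ∧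
    (p = 0 → n < m →
      comm (pd (tbv n)) (D k m p)
        = (((n : ℚ) * ((m : ℚ) - (n : ℚ))) / m) • mul (X (tbv (m - n)))) ∧
    (p = 0 → n = m →
      comm (pd (tbv n)) (D k m p) = mul (X (Var.x 0))) := by
  refine ⟨fun h => ?_, fun hp hnm => ?_, fun hp hnm => ?_⟩
  · match p, h with
    | 0, h =>
      have h : m < n := by omega
      have e : ((((0 : ℕ) : ℤ) - 1) * m + n).toNat = n - m := by
        push_cast
        omega
      rw [e, D, comm_add, comm_pd_D0der hn, comm_pd_mul, pderiv_tbv_Q0 hm hn, if_pos h,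
        if_neg (by omega), if_neg (by omega)]
      simp [mul]
    | 1, _ =>
      have e : ((((1 : ℕ) : ℤ) - 1) * m + n).toNat = n := by simp
      rw [e, D, comm_add, comm_pd_D1der hn, comm_pd_mul]
      simp [-pderiv_X, Derivation.leibniz, pderiv_tbv_x, mul]
    | p + 2, _ =>
      have e : ((((p + 2 : ℕ) : ℤ) - 1) * m + n).toNat = (p + 1) * m + n := by
        rw [← Int.toNat_natCast ((p + 1) * m + n)]
        congr 1
        push_cast
        ring
      rw [e, D, comm_add, comm_pd_Dbigder hn, comm_pd_Dbig2, add_zero]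
  · subst hp
    rw [D, comm_add, comm_pd_D0der hn, comm_pd_mul, pderiv_tbv_Q0 hm hn, if_neg (by omega),
      if_pos hnm, if_neg (by omega), zero_add, add_zero]
    refine LinearMap.ext fun g => ?_
    simp [mul]
  · subst hp hnm
    rw [D, comm_add, comm_pd_D0der hn, comm_pd_mul, pderiv_tbv_Q0 hm hn]
    simp
end
end

section
/- For all integers p ≥ 0 and q ≥ 0, the commutator [D_p, x_q·] of ℚ-linear endomorphisms of R is the operator of multiplication by some element of F. -/
open MvPolynomial

noncomputable section

namespace EBTH

theorem comm_add_left (f g h : Module.End ℚ P) : comm (f + g) h = comm f h + comm g h := by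
  simp only [comm, add_mul, mul_add]
  abel

theorem comm_mul_mul (f g : P) : comm (mul f) (mul g) = 0 := by
  apply LinearMap.ext
  intro a
  simp [comm, mul, mul_left_comm]

/-- The commutator of a derivation with multiplication by `f` is multiplication by its value
at `f`. -/
theorem comm_derivation_mul (d : Derivation ℚ P P) (f : P) :
    comm d.toLinearMap (mul f) = mul (d f) := by
  apply LinearMap.ext
  intro a
  simp [comm, mul, mul_comm]

theorem commute_pd_mul {v : Var} {f : P} (h : pderiv v f = 0) : Commute (pd v) (mul f) := by
  refine sub_eq_zero.mp ((comm_derivation_mul (pderiv v) f).trans ?_)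
  simp [h, mul]

theorem comm_Dbig2_mul_x (k m p q : ℕ) : comm (Dbig2 k m p) (mul (X (Var.x q))) = 0 := by
  have ht (n : ℕ) : Commute (pd (tv n)) (mul (X (Var.x q))) :=
    commute_pd_mul (pderiv_X_of_ne (by simp [tv]))
  have htb (n : ℕ) : Commute (pd (tbv n)) (mul (X (Var.x q))) :=
    commute_pd_mul (pderiv_X_of_ne (by simp [tbv]))
  refine sub_eq_zero.mpr (Commute.add_left ?_ ?_)
  · exact (Commute.sum_left _ _ _ fun i _ => (ht _).mul_left (ht _)).smul_left _
  · exact (Commute.sum_left _ _ _ fun i _ => (htb _).mul_left (htb _)).smul_left _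

theorem X_x_succ_mem_Fsub (n : ℕ) : X (Var.x (n + 1)) ∈ Fsub :=
  Algebra.subset_adjoin ⟨n, rfl⟩

end EBTH

open EBTH in
/-- for all `p, q ≥ 0`, the commutator `[D_p, x_q·]` is multiplication
by some element of `F = ℚ[x₁, x₂, …]`. -/
theorem stmt8 (k m : ℕ) (hk : 0 < k) (hm : 0 < m) (p q : ℕ) :
    ∃ f ∈ Fsub, comm (D k m p) (mul (X (Var.x q))) = mul f := by
  match p with
  | 0 =>
    refine ⟨((q : ℚ) + 1) • X (Var.x (q + 1)), Fsub.smul_mem (X_x_succ_mem_Fsub q) _, ?_⟩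
    rw [D, comm_add_left, comm_mul_mul, add_zero, D0der, comm_derivation_mul, mkDerivation_X]
  | 1 =>
    refine ⟨(q : ℚ) • X (Var.x q), ?_, ?_⟩
    · cases q with
      | zero => simp
      | succ n => exact Fsub.smul_mem (X_x_succ_mem_Fsub n) _
    · rw [D, comm_add_left, comm_mul_mul, add_zero, D1der, comm_derivation_mul, mkDerivation_X]
  | p + 2 =>
    refine ⟨if p + 1 < q then ((q : ℚ) - ((p + 1 : ℕ) : ℚ)) • X (Var.x (q - (p + 1))) else 0,
      ?_, ?_⟩
    · split_ifs with h
      · obtain ⟨n, hn⟩ : ∃ n, q - (p + 1) = n + 1 := ⟨q - (p + 1) - 1, by omega⟩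
        rw [hn]
        exact Fsub.smul_mem (X_x_succ_mem_Fsub n) _
      · exact Fsub.zero_mem
    · rw [D, comm_add_left, comm_Dbig2_mul_x, add_zero, Dbigder, comm_derivation_mul,
        mkDerivation_X]
end
end
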